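/- Let p₁,...,p₄ be pairwise coprime integers ≥ 2 and ℓ with 0 < ℓⱼ < pⱼ. If 1 + ∑ⱼ εⱼℓⱼ/pⱼ ∈ (0,2) for every sign choice ε ∈ {±1}⁴ with ∑ⱼεⱼ ∈ {2, -2, 0} (i.e., all sign patterns except all-plus and all-minus), and also 1 + ∑ⱼ ℓⱼ/pⱼ ∈ (2,3), then -∑_{ε∈{±1}⁴} (∏ⱼεⱼ)·B₂(frac-reduced argument) = 2(∑ⱼ ℓⱼ/pⱼ - 1), where each B₂ is evaluated at ((1+∑εⱼℓⱼ/pⱼ) mod 2)/2 ∈ [0,1). -/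

import Mathlib

open Finset

/-- The sign ±1 attached to a boolean. -/
def sgn (b : Bool) : ℤ := if b then 1 else -1

/-- The second Bernoulli polynomial `B₂(x) = x² - x + 1/6`. -/
def B2 (x : ℚ) : ℚ := x ^ 2 - x + 1/6

/-- Reduction of a rational number modulo 2 into `[0, 2)`. -/
def mod2 (x : ℚ) : ℚ := x - 2 * ⌊x / 2⌋

lemma mod2_eq_sub_of_mem {x : ℚ} (k : ℤ) (h0 : 2 * (k : ℚ) ≤ x) (h2 : x < 2 * k + 2) :
    mod2 x = x - 2 * k := by
  have hk : ⌊x / 2⌋ = k := Int.floor_eq_iff.2 ⟨by linarith, by linarith⟩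
  rw [mod2, hk]

lemma B2_half_one_add (y : ℚ) : B2 ((1 + y) / 2) = y ^ 2 / 4 - 1 / 12 := by
  unfold B2; ring

lemma sum_fin_four_bool (f : (Fin 4 → Bool) → ℚ) :
    ∑ ε, f ε = ∑ a, ∑ b, ∑ c, ∑ d, f ![a, b, c, d] := by
  let e : Bool × Bool × Bool × Bool ≃ (Fin 4 → Bool) :=
    { toFun := fun t => ![t.1, t.2.1, t.2.2.1, t.2.2.2]
      invFun := fun ε => (ε 0, ε 1, ε 2, ε 3)
      left_inv := fun _ => rfl
      right_inv := fun ε => by ext i; fin_cases i <;> rfl }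
  rw [← e.sum_comp]
  simp only [Fintype.sum_prod_type]
  rfl

/-- The signed sum of a quadratic polynomial in four signs vanishes. -/
lemma signed_sum_quadratic_eq_zero (x : Fin 4 → ℚ) (a c : ℚ) :
    ∑ ε : Fin 4 → Bool, ((∏ j, sgn (ε j) : ℤ) : ℚ) *
      (a * (∑ j, (sgn (ε j) : ℚ) * x j) ^ 2 + c) = 0 := by
  rw [sum_fin_four_bool]
  simp [Fin.sum_univ_four, Fin.prod_univ_four, sgn]
  ring

lemma B2_mod2_one_add {y : ℚ} (h0 : 0 < 1 + y) (h2 : 1 + y < 2) :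
    B2 (mod2 (1 + y) / 2) = y ^ 2 / 4 - 1 / 12 := by
  rw [mod2_eq_sub_of_mem 0 (by push_cast; linarith) (by push_cast; linarith),
    ← B2_half_one_add]
  simp

lemma B2_mod2_one_add_of_two_lt {y : ℚ} (h2 : 2 < 1 + y) (h3 : 1 + y < 3) :
    B2 (mod2 (1 + y) / 2) = y ^ 2 / 4 - 1 / 12 + (1 - y) := by
  rw [mod2_eq_sub_of_mem 1 (by push_cast; linarith) (by push_cast; linarith)]
  unfold B2; push_cast; ring

lemma B2_mod2_one_sub_of_two_lt {y : ℚ} (h2 : 2 < 1 + y) (h3 : 1 + y < 3) :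
    B2 (mod2 (1 + -y) / 2) = y ^ 2 / 4 - 1 / 12 + (1 - y) := by
  rw [mod2_eq_sub_of_mem (-1) (by push_cast; linarith) (by push_cast; linarith)]
  unfold B2; push_cast; ring

theorem signed_B2_sum_generic_case (p ℓ : Fin 4 → ℕ)
    (hp : ∀ j, 2 ≤ p j) (hcop : ∀ i j, i ≠ j → Nat.Coprime (p i) (p j))
    (hℓ : ∀ j, 0 < ℓ j ∧ ℓ j < p j)
    (hmixed : ∀ ε : Fin 4 → Bool, ε ≠ (fun _ => true) → ε ≠ (fun _ => false) →
      0 < 1 + ∑ j, (sgn (ε j) : ℚ) * (ℓ j : ℚ) / p j ∧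
        1 + ∑ j, (sgn (ε j) : ℚ) * (ℓ j : ℚ) / p j < 2)
    (h2 : 2 < 1 + ∑ j, (ℓ j : ℚ) / p j) (h3 : 1 + (∑ j, (ℓ j : ℚ) / p j) < 3) :
    -∑ ε : Fin 4 → Bool, ((∏ j, sgn (ε j) : ℤ) : ℚ) *
        B2 (mod2 (1 + ∑ j, (sgn (ε j) : ℚ) * (ℓ j : ℚ) / p j) / 2)
      = 2 * ((∑ j, (ℓ j : ℚ) / p j) - 1) := by
  simp only [mul_div_assoc] at hmixed ⊢
  set x : Fin 4 → ℚ := fun j => (ℓ j : ℚ) / p j with hx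
  change 2 < 1 + ∑ j, x j at h2
  change 1 + ∑ j, x j < 3 at h3
  have key : ∀ ε : Fin 4 → Bool, ((∏ j, sgn (ε j) : ℤ) : ℚ) *
      B2 (mod2 (1 + ∑ j, (sgn (ε j) : ℚ) * x j) / 2) =
      ((∏ j, sgn (ε j) : ℤ) : ℚ) *
        (1 / 4 * (∑ j, (sgn (ε j) : ℚ) * x j) ^ 2 + -1 / 12) +
      ((if ε = fun _ => true then 1 - ∑ j, x j else 0) +
        (if ε = fun _ => false then 1 - ∑ j, x j else 0)) := by
    intro ε
    by_cases ht : ε = fun _ => true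
    · subst ht
      have hne : (fun _ : Fin 4 => true) ≠ fun _ => false := by decide
      simp only [hne, sgn, if_true, if_false, Int.cast_one, one_mul, Finset.prod_const_one,
        B2_mod2_one_add_of_two_lt h2 h3]
      ring
    by_cases hf : ε = fun _ => false
    · subst hf
      simp only [ht, sgn, Bool.false_eq_true, if_true, if_false, Int.cast_neg, Int.cast_one,
        neg_mul, one_mul, Finset.sum_neg_distrib, B2_mod2_one_sub_of_two_lt h2 h3,
        Finset.prod_const, Finset.card_univ, Fintype.card_fin]
      norm_num
      ring
    · obtain ⟨h0, h1⟩ := hmixed ε ht hf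
      rw [if_neg ht, if_neg hf, B2_mod2_one_add h0 h1]
      ring
  change -∑ ε : Fin 4 → Bool, ((∏ j, sgn (ε j) : ℤ) : ℚ) *
      B2 (mod2 (1 + ∑ j, (sgn (ε j) : ℚ) * x j) / 2) = 2 * ((∑ j, x j) - 1)
  rw [Finset.sum_congr rfl fun ε _ => key ε, Finset.sum_add_distrib,
    signed_sum_quadratic_eq_zero, Finset.sum_add_distrib, Finset.sum_ite_eq', Finset.sum_ite_eq']
  simp only [Finset.mem_univ, if_true]
  ring
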